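/- arXiv:2007.13997 — 3 statements merged into one kernel-verified Lean document; each statement's English description precedes it below -/
import Mathlib

section
/- Fix Θ = (C₁,C₂,b) with min(C₁,C₂) > b > 0. For any (x',ξ',s') ∈ X there exist points (x,ξ₋,s) and (x,ξ₊,s) in the discrete set X_Δ such that (x',ξ',s') is centrally contained in both T(x,ξ₋,s) and T(x,ξ₊,s), i.e. 2⁻³s ≤ s' ≤ 2⁻²s, |x'-x| ≤ 2⁻⁴s, |ξ'-ξ₋| ≤ 2⁻⁸bs⁻¹ and |ξ'-ξ₊| ≤ 2⁻⁸bs⁻¹, and moreover T(x',ξ',s') ⊆ T(x,ξ₋,s) ∪ T(x,ξ₊,s) and T(x',ξ',s') ∩ T^b(x,ξ₋,s) ∩ T^b(x,ξ₊,s) ⊆ T^b(x',ξ',s'). -/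
open MeasureTheory Real Complex Filter Function Set
open scoped ENNReal NNReal FourierTransform Classical

noncomputable section

/-- The `L¹`-normalized wave packet `φ_{y,η,t}(x) = e^{-iη(y-x)} t⁻¹ conj(φ((y-x)/t))`. -/
def wavePacket (φ : SchwartzMap ℝ ℂ) (y η t : ℝ) (x : ℝ) : ℂ :=
  Complex.exp (-(Complex.I * η * (y - x))) * (t : ℂ)⁻¹ * (starRingEnd ℂ) (φ ((y - x) / t))

/-- `⟨f,g⟩ = ∫ f · conj g`. -/
def pairing (f g : ℝ → ℂ) : ℂ := ∫ x, f x * (starRingEnd ℂ) (g x)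

/-- The wave packet transform `P(f)(y,η,t) = ⟨f, φ_{y,η,t}⟩`. -/
def wpt (φ : SchwartzMap ℝ ℂ) (f : ℝ → ℂ) (p : ℝ × ℝ × ℝ) : ℂ :=
  pairing f (wavePacket φ p.1 p.2.1 p.2.2)

/-- The 3D tent `T(x,ξ,s)`. -/
def Tent (C₁ C₂ : ℝ) (x ξ s : ℝ) : Set (ℝ × ℝ × ℝ) :=
  {p | 0 < p.2.2 ∧ p.2.2 < s ∧ |p.1 - x| < s - p.2.2 ∧
    -(C₁ / p.2.2) < p.2.1 - ξ ∧ p.2.1 - ξ < C₂ / p.2.2}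

/-- The core `T^b(x,ξ,s)` of a tent. -/
def TentCore (C₁ C₂ b : ℝ) (x ξ s : ℝ) : Set (ℝ × ℝ × ℝ) :=
  {p ∈ Tent C₁ C₂ x ξ s | |p.2.1 - ξ| ≤ b / p.2.2}

/-- The lacunary part `T^ℓ(x,ξ,s)` of a tent. -/
def TentLac (C₁ C₂ b : ℝ) (x ξ s : ℝ) : Set (ℝ × ℝ × ℝ) :=
  Tent C₁ C₂ x ξ s \ TentCore C₁ C₂ b x ξ s

/-- `w(a,b) = ∫_a^b w`. -/
def wInt (w : ℝ → ℝ) (a b : ℝ) : ℝ := ∫ u in a..b, w u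

/-- The Muckenhoupt `A_p` condition on `ℝ` with constant bound `A`. -/
def IsApWeight (w : ℝ → ℝ) (p A : ℝ) : Prop :=
  (∀ x, 0 ≤ w x) ∧ LocallyIntegrable w volume ∧
    ∀ a b : ℝ, a < b →
      ((b - a)⁻¹ * ∫ u in a..b, w u) *
        ((b - a)⁻¹ * ∫ u in a..b, w u ^ (-1 / (p - 1))) ^ (p - 1) ≤ A

/-- `‖f‖_{L^q(w)}^q = ∫ |f|^q w`. -/
def wLqPow (w : ℝ → ℝ) (q : ℝ) (f : ℝ → ℂ) : ℝ≥0∞ :=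
  ∫⁻ x, (ENNReal.ofReal ‖f x‖) ^ q * ENNReal.ofReal (w x)

/-- The weighted size `S^w(F)(T(x,ξ,s))`. -/
def sizeW (w : ℝ → ℝ) (C₁ C₂ b : ℝ) (F : ℝ × ℝ × ℝ → ℂ) (x ξ s : ℝ) : ℝ≥0∞ :=
  ((ENNReal.ofReal (wInt w (x - s) (x + s)))⁻¹ *
      ∫⁻ p in TentLac C₁ C₂ b x ξ s,
        (ENNReal.ofReal ‖F p‖) ^ 2 *
          ENNReal.ofReal (wInt w (p.1 - p.2.2) (p.1 + p.2.2)) / ENNReal.ofReal p.2.2) ^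
      (1 / 2 : ℝ) +
    ⨆ p ∈ TentCore C₁ C₂ b x ξ s, ENNReal.ofReal ‖F p‖

/-- The outer measure generated by tents with pre-measure `σ^w(T(x,ξ,s)) = w(x-s,x+s)`. -/
def outerW (w : ℝ → ℝ) (C₁ C₂ : ℝ) (A : Set (ℝ × ℝ × ℝ)) : ℝ≥0∞ :=
  ⨅ (c : ℕ → ℝ × ℝ × ℝ) (_ : A ⊆ ⋃ k, Tent C₁ C₂ (c k).1 (c k).2.1 (c k).2.2),
    ∑' k, ENNReal.ofReal (wInt w ((c k).1 - (c k).2.2) ((c k).1 + (c k).2.2))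

/-- The super level measure `μ^w(S^w(F) > λ)`. -/
def superLevelW (w : ℝ → ℝ) (C₁ C₂ b : ℝ) (F : ℝ × ℝ × ℝ → ℂ) (lam : ℝ) : ℝ≥0∞ :=
  ⨅ (A : Set (ℝ × ℝ × ℝ)) (_ : MeasurableSet A)
    (_ : ∀ x ξ s : ℝ, sizeW w C₁ C₂ b (Set.indicator Aᶜ F) x ξ s ≤ ENNReal.ofReal lam),
    outerW w C₁ C₂ A

/-- The outer `L^q` quasi-norm `‖F‖_{L^q(X,σ^w,S^w)}`. -/
def outerLqW (w : ℝ → ℝ) (C₁ C₂ b q : ℝ) (F : ℝ × ℝ × ℝ → ℂ) : ℝ≥0∞ :=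
  (∫⁻ lam in Set.Ioi (0 : ℝ),
      ENNReal.ofReal (q * lam ^ (q - 1)) * superLevelW w C₁ C₂ b F lam) ^ (1 / q)

/-- The weak outer `L^q` quasi-norm `‖F‖_{L^{q,∞}(X,σ^w,S^w)}`. -/
def outerLqWeakW (w : ℝ → ℝ) (C₁ C₂ b q : ℝ) (F : ℝ × ℝ × ℝ → ℂ) : ℝ≥0∞ :=
  ⨆ (lam : ℝ) (_ : 0 < lam),
    ENNReal.ofReal lam * (superLevelW w C₁ C₂ b F lam) ^ (1 / q)

/-- The discrete parameter set `X_Δ`. -/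
def XDelta (b : ℝ) : Set (ℝ × ℝ × ℝ) :=
  {p | ∃ k m n : ℤ, p.1 = (2 : ℝ) ^ (k - 4) * (n : ℝ) ∧
    p.2.1 = (2 : ℝ) ^ (-k - 8) * b * (m : ℝ) ∧ p.2.2 = (2 : ℝ) ^ k}

/-- Every real lies in a cell `[δ n, δ n + δ)` of the grid of mesh `δ`. -/
lemma exists_int_mul_le_lt_add {δ : ℝ} (hδ : 0 < δ) (a : ℝ) :
    ∃ n : ℤ, δ * n ≤ a ∧ a < δ * n + δ := by
  refine ⟨⌊a / δ⌋, ?_, ?_⟩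
  · rw [mul_comm]
    exact (le_div_iff₀ hδ).1 (Int.floor_le _)
  · have h := (div_lt_iff₀ hδ).1 (Int.lt_floor_add_one (a / δ))
    linarith

/-- If `ξm ≤ ξ ≤ ξp` with `ξp - ξm` small, a tent centred at `ξ` is covered by wider tents
centred at `ξm` and `ξp`. -/
lemma tent_subset_union_tent {C₁ C₂ x x' ξ ξm ξp s s' : ℝ} (hm : ξm ≤ ξ) (hp : ξ ≤ ξp)
    (hx : |x' - x| ≤ s - s') (hs : s' ≤ s)
    (hgap : ∀ t, 0 < t → t < s' → ξp - ξm < C₁ / t + C₂ / t) :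
    Tent C₁ C₂ x' ξ s' ⊆ Tent C₁ C₂ x ξm s ∪ Tent C₁ C₂ x ξp s := by
  rintro ⟨y, η, t⟩ ⟨ht, hts, hy, h₁, h₂⟩
  dsimp only at ht hts hy h₁ h₂
  have hyx : |y - x| < s - t := by
    have := abs_sub_le y x' x
    linarith
  have hg := hgap t ht hts
  by_cases h : η - ξm < C₂ / t
  · exact Or.inl ⟨ht, by dsimp only; linarith, hyx, by dsimp only; linarith, h⟩
  · exact Or.inr ⟨ht, by dsimp only; linarith, hyx, by dsimp only; linarith,
      by dsimp only; linarith⟩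

/-- If `ξm ≤ ξ ≤ ξp`, the common core of tents centred at `ξm` and `ξp` lies in the core
of a tent centred at `ξ`. -/
lemma tent_inter_tentCore_subset {C₁ C₂ b x x' ξ ξm ξp s s' : ℝ} (hm : ξm ≤ ξ) (hp : ξ ≤ ξp) :
    Tent C₁ C₂ x' ξ s' ∩ TentCore C₁ C₂ b x ξm s ∩ TentCore C₁ C₂ b x ξp s ⊆
      TentCore C₁ C₂ b x' ξ s' := by
  rintro ⟨y, η, t⟩ ⟨⟨hT, -, hcm⟩, -, hcp⟩
  refine ⟨hT, ?_⟩
  dsimp only at hcm hcp ⊢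
  rw [abs_le] at *
  constructor <;> linarith

/-- Lemma 4.2: every point of `X` is centrally contained in a pair of
discrete parameter tents which together cover its tent and whose common core lies in its core. -/
theorem central_containment_in_discrete_tents (C₁ C₂ b : ℝ) (hb : 0 < b)
    (hbmin : b < min C₁ C₂) (x' ξ' s' : ℝ) (hs' : 0 < s') :
    ∃ x ξm ξp s : ℝ,
      (x, ξm, s) ∈ XDelta b ∧ (x, ξp, s) ∈ XDelta b ∧
      s / 2 ^ 3 ≤ s' ∧ s' ≤ s / 2 ^ 2 ∧ |x' - x| ≤ s / 2 ^ 4 ∧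
      |ξ' - ξm| ≤ b / 2 ^ 8 * s⁻¹ ∧ |ξ' - ξp| ≤ b / 2 ^ 8 * s⁻¹ ∧
      Tent C₁ C₂ x' ξ' s' ⊆ Tent C₁ C₂ x ξm s ∪ Tent C₁ C₂ x ξp s ∧
      Tent C₁ C₂ x' ξ' s' ∩ TentCore C₁ C₂ b x ξm s ∩ TentCore C₁ C₂ b x ξp s ⊆
        TentCore C₁ C₂ b x' ξ' s' := by
  obtain ⟨j, hj, hj'⟩ := exists_mem_Ico_zpow hs' (one_lt_two : (1 : ℝ) < 2)
  obtain ⟨s, hs⟩ : ∃ s : ℝ, s = (2 : ℝ) ^ (j + 3) := ⟨_, rfl⟩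
  have hs0 : 0 < s := hs ▸ by positivity
  have h2 : (2 : ℝ) ≠ 0 := two_ne_zero
  have hsj : s = 2 ^ j * 8 := by rw [hs, zpow_add₀ h2]; norm_num
  have hsj' : (2 : ℝ) ^ (j + 1) = 2 ^ j * 2 := by rw [zpow_add₀ h2]; norm_num
  have hsx : (2 : ℝ) ^ (j + 3 - 4) = s / 16 := by rw [hs, zpow_sub₀ h2]; norm_num
  have hsξ : (2 : ℝ) ^ (-(j + 3) - 8) * b = b / 2 ^ 8 * s⁻¹ := by
    rw [hs, zpow_sub₀ h2, zpow_neg]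
    norm_num
    ring
  obtain ⟨δ, hδ⟩ : ∃ δ : ℝ, δ = b / 2 ^ 8 * s⁻¹ := ⟨_, rfl⟩
  have hδ0 : 0 < δ := hδ ▸ by positivity
  obtain ⟨n, hn, hn'⟩ := exists_int_mul_le_lt_add (δ := s / 16) (by positivity) x'
  obtain ⟨m, hm, hm'⟩ := exists_int_mul_le_lt_add hδ0 ξ'
  have hx : |x' - s / 16 * n| ≤ s / 2 ^ 4 := by
    rw [abs_le]
    constructor <;> linarith
  refine ⟨s / 16 * n, δ * m, δ * m + δ, s, ⟨j + 3, m, n, ?_, ?_, hs⟩,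
    ⟨j + 3, m + 1, n, ?_, ?_, hs⟩, by linarith, by linarith, hx, ?_, ?_,
    tent_subset_union_tent hm hm'.le (by linarith) (by linarith) fun t ht hts => ?_,
    tent_inter_tentCore_subset hm hm'.le⟩
  · rw [hsx]
  · rw [hsξ, hδ]
  · rw [hsx]
  · rw [hsξ, ← hδ]
    push_cast
    ring
  · rw [← hδ, abs_le]
    constructor <;> linarith
  · rw [← hδ, abs_le]
    constructor <;> linarith
  · obtain ⟨hb₁, hb₂⟩ := lt_min_iff.1 hbmin
    have hδs : δ < b / s := by
      rw [hδ, div_eq_mul_inv b s]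
      exact mul_lt_mul_of_pos_right (by linarith) (by positivity)
    have hst : b / s ≤ b / t := by
      gcongr
      linarith
    have h₁ : b / t < C₁ / t := by gcongr
    have h₂ : 0 < C₂ / t := div_pos (hb.trans hb₂) ht
    linarith
end
end

section
/- Fix Θ = (C₁,C₂,b) with min(C₁,C₂) > b > 0. Let (y_k,η_k,t_k) ∈ X and (x_k,ξ_k,s_k) ∈ X (indexed by k in a countable, linearly ordered index set) satisfy: (i) each (y_k,η_k,t_k) is centrally contained in T(x_k,ξ_k,s_k), i.e. 2⁻³s_k ≤ t_k ≤ 2⁻²s_k, |y_k - x_k| ≤ 2⁻⁴s_k and |η_k - ξ_k| ≤ 2⁻⁸b·s_k⁻¹; (ii) the heights s_k are non-increasing in k; (iii) for all j < k, (y_k,η_k,t_k) ∉ T(x_j,ξ_j,s_j). Then the collection of points {(y_k,η_k,t_k)} is well separated with constants α = 2⁻² and β = 2⁻⁶b; that is, for any j ≠ k, either |y_j - y_k| > 2⁻²·max(t_j,t_k) or |η_j - η_k| > 2⁻⁶b·max(1/t_j, 1/t_k). -/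
open MeasureTheory Real Complex Filter Function Set
open scoped ENNReal NNReal FourierTransform Classical

noncomputable section

/-- A point close to a point centrally contained in a tent, and of at most twice its height,
lies in that tent. -/
theorem mem_tent_of_close {C₁ C₂ b : ℝ} (hb : 0 < b) (hbmin : b < min C₁ C₂)
    {y η t x ξ s y' η' t' : ℝ} (ht : 0 < t) (ht' : 0 < t')
    (hts : t ≤ s / 2 ^ 2) (hts' : t' ≤ s / 2 ^ 2) (htt : t' ≤ 2 * t)
    (hy : |y - x| ≤ s / 2 ^ 4) (hη : |η - ξ| ≤ b / 2 ^ 8 * s⁻¹)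
    (hyy : |y - y'| ≤ 2⁻¹ ^ 2 * max t t')
    (hηη : |η - η'| ≤ 2⁻¹ ^ 6 * b * max t⁻¹ t'⁻¹) :
    (y', η', t') ∈ Tent C₁ C₂ x ξ s := by
  obtain ⟨hb₁, hb₂⟩ := lt_min_iff.mp hbmin
  have hmax : max t t' ≤ s / 2 ^ 2 := max_le hts hts'
  have hinv : max t⁻¹ t'⁻¹ ≤ 2 / t' := by
    refine max_le ?_ ?_
    · rw [inv_eq_one_div, div_le_div_iff₀ ht ht']
      linarith
    · rw [inv_eq_one_div]
      gcongr
      norm_num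
  have hsinv : s⁻¹ ≤ 1 / t' := by
    rw [inv_eq_one_div]
    gcongr
    linarith
  have hη' : |η - ξ| ≤ b / 2 ^ 8 * (1 / t') := hη.trans (by gcongr)
  have hηη' : |η - η'| ≤ 2⁻¹ ^ 6 * b * (2 / t') := hηη.trans (by gcongr)
  have hbt : 0 < b / t' := by positivity
  have h₁ : b / 2 ^ 8 * (1 / t') = b / t' / 256 := by ring
  have h₂ : 2⁻¹ ^ 6 * b * (2 / t') = b / t' / 32 := by ring
  have hC₁ : b / t' < C₁ / t' := by gcongr
  have hC₂ : b / t' < C₂ / t' := by gcongr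
  rw [h₁, abs_le] at hη'
  rw [h₂, abs_le] at hηη'
  rw [abs_le] at hy hyy
  refine ⟨ht', ?_, abs_lt.mpr ⟨?_, ?_⟩, ?_, ?_⟩ <;> dsimp only <;> linarith

/-- Claim 4.3: points selected by the `L^∞` selection algorithm are
well separated with constants `α = 2⁻²`, `β = 2⁻⁶ b`. -/
theorem selected_points_well_separated (C₁ C₂ b : ℝ) (hb : 0 < b) (hbmin : b < min C₁ C₂)
    (ι : Type) [Countable ι] [LinearOrder ι]
    (y η t x ξ s : ι → ℝ)
    (ht : ∀ k, 0 < t k) (hs : ∀ k, 0 < s k)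
    (hcentral : ∀ k, s k / 2 ^ 3 ≤ t k ∧ t k ≤ s k / 2 ^ 2 ∧
      |y k - x k| ≤ s k / 2 ^ 4 ∧ |η k - ξ k| ≤ b / 2 ^ 8 * (s k)⁻¹)
    (hmono : Antitone s)
    (hsel : ∀ j k : ι, j < k → (y k, η k, t k) ∉ Tent C₁ C₂ (x j) (ξ j) (s j)) :
    ∀ j k : ι, j ≠ k →
      |y j - y k| > 2⁻¹ ^ 2 * max (t j) (t k) ∨
      |η j - η k| > 2⁻¹ ^ 6 * b * max (t j)⁻¹ (t k)⁻¹ := by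
  have key : ∀ j k : ι, j < k →
      |y j - y k| > 2⁻¹ ^ 2 * max (t j) (t k) ∨
      |η j - η k| > 2⁻¹ ^ 6 * b * max (t j)⁻¹ (t k)⁻¹ := by
    intro j k hjk
    by_contra! hclose
    obtain ⟨hlow, hup, hy, hη⟩ := hcentral j
    have hup' := (hcentral k).2.1
    have hsk := hmono hjk.le
    exact hsel j k hjk (mem_tent_of_close hb hbmin (ht j) (ht k) hup
      (by linarith) (by linarith) hy hη hclose.1 hclose.2)
  intro j k hjk
  rcases hjk.lt_or_gt with h | h
  · exact key j k h
  · rw [abs_sub_comm (y j), abs_sub_comm (η j), max_comm (t j), max_comm (t j)⁻¹]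
    exact key k j h
end
end

section
/- Fix Θ = (C₁,C₂,b) with min(C₁,C₂) > b > 0. For x' ∈ ℝ and s' > 0 define the triangular strip E_{x',s'} = {(y,η,t) ∈ X : 0 < t < s', |y-x'| < s'-t}. Suppose T(x,ξ,s) ∩ E_{x',s'} is nonempty. Then the open intervals (x-s,x+s) and (x'-s',x'+s') intersect in a nonempty open interval (x''-s'', x''+s'') (defining x'' and s'' > 0), and T(x,ξ,s) ∩ E_{x',s'} = T(x'',ξ,s''); moreover T^b(x,ξ,s) ∩ E_{x',s'} = T^b(x'',ξ,s'') and T^ℓ(x,ξ,s) ∩ E_{x',s'} = T^ℓ(x'',ξ,s''). -/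
open MeasureTheory Real Complex Filter Function Set
open scoped ENNReal NNReal FourierTransform Classical

noncomputable section

/-- The triangular strip `E_{x',s'}`. -/
def Strip (x' s' : ℝ) : Set (ℝ × ℝ × ℝ) :=
  {p | 0 < p.2.2 ∧ p.2.2 < s' ∧ |p.1 - x'| < s' - p.2.2}

theorem mem_strip_iff {x s : ℝ} {p : ℝ × ℝ × ℝ} :
    p ∈ Strip x s ↔ 0 < p.2.2 ∧ x - s < p.1 - p.2.2 ∧ p.1 + p.2.2 < x + s := by
  simp only [Strip, mem_ofPred_eq, abs_lt]
  constructor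
  · rintro ⟨ht, -, h₁, h₂⟩
    exact ⟨ht, by linarith, by linarith⟩
  · rintro ⟨ht, h₁, h₂⟩
    exact ⟨ht, by linarith, by linarith, by linarith⟩

theorem mem_tent_iff {C₁ C₂ x ξ s : ℝ} {p : ℝ × ℝ × ℝ} :
    p ∈ Tent C₁ C₂ x ξ s ↔
      p ∈ Strip x s ∧ -(C₁ / p.2.2) < p.2.1 - ξ ∧ p.2.1 - ξ < C₂ / p.2.2 := by
  simp only [Tent, Strip, mem_ofPred_eq, and_assoc]

/-- Two triangular strips meet in the triangular strip over the intersection of their bases. -/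
theorem strip_inter_strip {x s x' s' x'' s'' : ℝ}
    (hlo : x'' - s'' = max (x - s) (x' - s')) (hhi : x'' + s'' = min (x + s) (x' + s')) :
    Strip x s ∩ Strip x' s' = Strip x'' s'' := by
  ext p
  simp only [mem_inter_iff, mem_strip_iff, hlo, hhi, max_lt_iff, lt_min_iff]
  tauto

/-- Remark 4.1: the intersection of a 3D tent with a triangular strip
is again a 3D tent, compatibly with cores and lacunary parts. -/
theorem tent_inter_strip_eq_tent (C₁ C₂ b : ℝ) (hb : 0 < b) (hbmin : b < min C₁ C₂)
    (x ξ s x' s' : ℝ) (hne : (Tent C₁ C₂ x ξ s ∩ Strip x' s').Nonempty) :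
    ∃ x'' s'' : ℝ, 0 < s'' ∧
      x'' - s'' = max (x - s) (x' - s') ∧ x'' + s'' = min (x + s) (x' + s') ∧
      Tent C₁ C₂ x ξ s ∩ Strip x' s' = Tent C₁ C₂ x'' ξ s'' ∧
      TentCore C₁ C₂ b x ξ s ∩ Strip x' s' = TentCore C₁ C₂ b x'' ξ s'' ∧
      TentLac C₁ C₂ b x ξ s ∩ Strip x' s' = TentLac C₁ C₂ b x'' ξ s'' := by
  obtain ⟨p, hpT, hpS⟩ := hne
  obtain ⟨x'', s'', hlo, hhi⟩ : ∃ x'' s'' : ℝ,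
      x'' - s'' = max (x - s) (x' - s') ∧ x'' + s'' = min (x + s) (x' + s') :=
    ⟨(min (x + s) (x' + s') + max (x - s) (x' - s')) / 2,
      (min (x + s) (x' + s') - max (x - s) (x' - s')) / 2, by ring, by ring⟩
  have hstrip := strip_inter_strip hlo hhi
  have hp : p ∈ Strip x'' s'' := hstrip ▸ ⟨(mem_tent_iff.1 hpT).1, hpS⟩
  have htent : Tent C₁ C₂ x ξ s ∩ Strip x' s' = Tent C₁ C₂ x'' ξ s'' := by
    ext q
    simp only [mem_inter_iff, mem_tent_iff, ← hstrip]
    tauto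
  have hcore : TentCore C₁ C₂ b x ξ s ∩ Strip x' s' = TentCore C₁ C₂ b x'' ξ s'' := by
    ext q
    have hq := Set.ext_iff.1 htent q
    simp only [mem_inter_iff] at hq
    simp only [TentCore, mem_inter_iff, mem_ofPred_eq, ← hq]
    tauto
  refine ⟨x'', s'', hp.1.trans hp.2.1, hlo, hhi, htent, hcore, ?_⟩
  rw [TentLac, TentLac, ← htent, ← hcore]
  ext q
  simp only [mem_inter_iff, Set.mem_sdiff]
  tauto
end
end
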